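/- Let G be a finite simple graph on n vertices, and for each vertex v let c(v) denote the order of the largest clique of G containing v. Then |E(G)| = (n/2) · Σ_{v ∈ V(G)} (c(v) − 1)/c(v) holds (as an equality of real numbers) if and only if there exists r ≥ 1 with r ∣ n such that G is isomorphic to the Turán graph T(n,r), i.e., G is a regular Turán graph with r parts all of size n/r. -/

import Mathlib

open Finset SimpleGraph

/-- `cliqueOrderAt G v` is the order of the largest clique of `G` containing `v`
(`1` if `v` is isolated, witnessed by the singleton clique `{v}`). -/
noncomputable def cliqueOrderAt {V : Type*} (G : SimpleGraph V) (v : V) : ℕ :=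
  sSup {r : ℕ | ∃ s : Finset V, G.IsNClique r s ∧ v ∈ s}

namespace SimpleGraph

section

variable {V : Type*} {G : SimpleGraph V}

/-- A vertex outside a clique `K` sees fewer vertices of `K` than the
order of any clique through it. -/
lemma sum_adj_clique_le [DecidableEq V] [DecidableRel G.Adj] {s K : Finset V} {c : V → ℕ}
    (hc : ∀ t ⊆ s, G.IsClique (t : Set V) → ∀ v ∈ t, #t ≤ c v)
    (hKs : K ⊆ s) (hK : G.IsClique (K : Set V)) {v : V} (hv : v ∈ s \ K) :
    ∑ u ∈ K, (if G.Adj v u then (1 : ℝ) else 0) ≤ c v - 1 := by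
  obtain ⟨hvs, hvK⟩ := mem_sdiff.1 hv
  have hclique : G.IsClique (insert v {u ∈ K | G.Adj v u} : Finset V) := by
    rw [coe_insert, isClique_insert]
    refine ⟨hK.subset (coe_subset.2 (filter_subset _ _)), fun u hu _ ↦ ?_⟩
    exact (mem_filter.1 (mem_coe.1 hu)).2
  have hsub : insert v {u ∈ K | G.Adj v u} ⊆ s :=
    insert_subset hvs ((filter_subset _ _).trans hKs)
  have h := hc _ hsub hclique v (mem_insert_self _ _)
  rw [card_insert_of_notMem (by simp [hvK])] at h
  rw [sum_boole]
  have : ((#{u ∈ K | G.Adj v u} : ℕ) : ℝ) + 1 ≤ c v := by exact_mod_cast h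
  linarith

lemma sum_adj_sdiff [DecidableEq V] [DecidableRel G.Adj] {s K : Finset V} (hKs : K ⊆ s) :
    ∑ u ∈ s, ∑ v ∈ s, (if G.Adj u v then (1 : ℝ) else 0) =
      ∑ u ∈ s \ K, ∑ v ∈ s \ K, (if G.Adj u v then (1 : ℝ) else 0) +
      2 * ∑ u ∈ s \ K, ∑ v ∈ K, (if G.Adj u v then (1 : ℝ) else 0) +
      ∑ u ∈ K, ∑ v ∈ K, (if G.Adj u v then (1 : ℝ) else 0) := by
  have h : ∑ u ∈ K, ∑ v ∈ s \ K, (if G.Adj u v then (1 : ℝ) else 0) =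
      ∑ u ∈ s \ K, ∑ v ∈ K, (if G.Adj u v then (1 : ℝ) else 0) := by
    rw [sum_comm]
    simp_rw [G.adj_comm]
  simp_rw [← sum_sdiff hKs, sum_add_distrib]
  rw [h]
  ring

lemma IsClique.sum_adj [DecidableEq V] [DecidableRel G.Adj] {K : Finset V}
    (hK : G.IsClique (K : Set V)) :
    ∑ u ∈ K, ∑ v ∈ K, (if G.Adj u v then (1 : ℝ) else 0) = #K * (#K - 1) := by
  have h : ∀ u ∈ K, ∑ v ∈ K, (if G.Adj u v then (1 : ℝ) else 0) = #K - 1 := by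
    intro u hu
    rw [sum_boole, show {v ∈ K | G.Adj u v} = K.erase u by
      ext v
      simp only [mem_filter, mem_erase]
      exact ⟨fun h ↦ ⟨h.2.ne', h.1⟩, fun h ↦ ⟨h.2, hK hu h.2 h.1.symm⟩⟩,
      cast_card_erase_of_mem hu]
  rw [sum_congr rfl h, sum_const, nsmul_eq_mul]

/-- Deleting a maximum clique `K`: the localized Turán inequality passes from `s \ K` to `s`, with
a gain from every vertex whose weight is smaller than `#K`. -/
lemma sum_adj_add_gain_le [DecidableEq V] [DecidableRel G.Adj] {s K : Finset V} {c : V → ℕ}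
    (hc : ∀ t ⊆ s, G.IsClique (t : Set V) → ∀ v ∈ t, #t ≤ c v)
    (hKs : K ⊆ s) (hK : G.IsClique (K : Set V)) (hne : K.Nonempty)
    (hcK : ∀ v ∈ s, c v ≤ #K)
    (ih : ∑ u ∈ s \ K, ∑ v ∈ s \ K, (if G.Adj u v then (1 : ℝ) else 0) ≤
      #(s \ K) * ∑ v ∈ s \ K, ((c v : ℝ) - 1) / c v) :
    ∑ u ∈ s, ∑ v ∈ s, (if G.Adj u v then (1 : ℝ) else 0) +
        ∑ v ∈ s \ K, ((#K : ℝ) - c v) * (2 * c v - 1) / c v ≤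
      #s * ∑ v ∈ s, ((c v : ℝ) - 1) / c v := by
  have hcross : ∑ u ∈ s \ K, ∑ v ∈ K, (if G.Adj u v then (1 : ℝ) else 0) ≤
      ∑ v ∈ s \ K, ((c v : ℝ) - 1) := sum_le_sum fun v hv ↦ sum_adj_clique_le hc hKs hK hv
  have hKsum : ∑ v ∈ K, ((c v : ℝ) - 1) / c v = #K - 1 := by
    have h : ∀ v ∈ K, ((c v : ℝ) - 1) / c v = (#K - 1) / #K := by
      intro v hv
      rw [le_antisymm (hcK v (hKs hv)) (hc K hKs hK v hv)]
    rw [sum_congr rfl h, sum_const, nsmul_eq_mul]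
    have : (#K : ℝ) ≠ 0 := by exact_mod_cast hne.card_ne_zero
    field_simp
  have hcard : (#s : ℝ) = #(s \ K) + #K := by exact_mod_cast (card_sdiff_add_card_eq_card hKs).symm
  have hgain : ∑ v ∈ s \ K, ((#K : ℝ) - c v) * (2 * c v - 1) / c v +
      2 * ∑ v ∈ s \ K, ((c v : ℝ) - 1) =
      #(s \ K) * ((#K : ℝ) - 1) + #K * ∑ v ∈ s \ K, ((c v : ℝ) - 1) / c v := by
    rw [← nsmul_eq_mul, ← sum_const, mul_sum, mul_sum, ← sum_add_distrib, ← sum_add_distrib]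
    refine sum_congr rfl fun v hv ↦ ?_
    have h1 : 1 ≤ c v := hc {v} (by simpa using (mem_sdiff.1 hv).1) (by simp) v (by simp)
    have : (c v : ℝ) ≠ 0 := by exact_mod_cast (by omega : c v ≠ 0)
    field_simp
    ring
  rw [sum_adj_sdiff hKs, hK.sum_adj, ← sum_sdiff hKs, hKsum, hcard]
  linarith

lemma exists_maximum_clique_subset (G : SimpleGraph V) (s : Finset V) :
    ∃ K ⊆ s, G.IsClique (K : Set V) ∧ ∀ t ⊆ s, G.IsClique (t : Set V) → #t ≤ #K := by
  classical
  obtain ⟨K, hK, hmax⟩ := exists_max_image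
    (s.powerset.filter fun t : Finset V ↦ G.IsClique (t : Set V)) card ⟨∅, by simp⟩
  simp only [mem_filter, mem_powerset] at hK hmax
  exact ⟨K, hK.1, hK.2, fun t ht hc ↦ hmax t ⟨ht, hc⟩⟩

/-- The vertex-localized Turán inequality, on the subgraph induced by `s`. -/
theorem sum_adj_le [DecidableEq V] [DecidableRel G.Adj] (s : Finset V) (c : V → ℕ)
    (hc : ∀ t ⊆ s, G.IsClique (t : Set V) → ∀ v ∈ t, #t ≤ c v) :
    ∑ u ∈ s, ∑ v ∈ s, (if G.Adj u v then (1 : ℝ) else 0) ≤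
      #s * ∑ v ∈ s, ((c v : ℝ) - 1) / c v := by
  induction s using Finset.strongInduction generalizing c with
  | H s ih =>
  rcases s.eq_empty_or_nonempty with rfl | ⟨x, hx⟩
  · simp
  obtain ⟨K, hKs, hK, hmax⟩ := G.exists_maximum_clique_subset s
  have hKpos : 1 ≤ #K := hmax {x} (by simpa using hx) (by simp)
  have hKne : K.Nonempty := card_pos.1 hKpos
  have hc' : ∀ t ⊆ s, G.IsClique (t : Set V) → ∀ v ∈ t, #t ≤ min (c v) #K :=
    fun t ht htc v hv ↦ le_min (hc t ht htc v hv) (hmax t ht htc)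
  have hpos : ∀ v ∈ s, 1 ≤ min (c v) #K := fun v hv ↦
    hc' {v} (by simpa using hv) (by simp) v (by simp)
  have h := sum_adj_add_gain_le hc' hKs hK hKne (fun v _ ↦ min_le_right _ _)
    (ih _ (sdiff_ssubset hKs hKne) _ fun t ht ↦ hc' t (ht.trans sdiff_subset))
  have hgain : 0 ≤ ∑ v ∈ s \ K,
      ((#K : ℝ) - (min (c v) #K : ℕ)) * (2 * (min (c v) #K : ℕ) - 1) / (min (c v) #K : ℕ) := by
    refine sum_nonneg fun v hv ↦ div_nonneg (mul_nonneg ?_ ?_) (Nat.cast_nonneg _)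
    · exact sub_nonneg.2 (by exact_mod_cast min_le_right _ _)
    · have : (1 : ℝ) ≤ (min (c v) #K : ℕ) := by exact_mod_cast hpos v (mem_sdiff.1 hv).1
      linarith
  refine (le_of_add_le_of_nonneg_left h hgain).trans ?_
  gcongr ?_ * ∑ v ∈ _, ?_ with v hv
  have h1 : (1 : ℝ) ≤ (min (c v) #K : ℕ) := by exact_mod_cast hpos v hv
  have h2 : ((min (c v) #K : ℕ) : ℝ) ≤ c v := by exact_mod_cast min_le_left _ _
  rw [div_le_div_iff₀ (by linarith) (by linarith)]
  linarith

/-- A graph attaining the localized Turán bound has constant weight. -/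
lemma exists_weight_eq_of_sum_adj_eq [DecidableEq V] [DecidableRel G.Adj] {s : Finset V}
    (hs : s.Nonempty) {c : V → ℕ}
    (hc : ∀ t ⊆ s, G.IsClique (t : Set V) → ∀ v ∈ t, #t ≤ c v)
    (hc_attained : ∀ v ∈ s, ∃ t ⊆ s, G.IsClique (t : Set V) ∧ #t = c v)
    (heq : ∑ u ∈ s, ∑ v ∈ s, (if G.Adj u v then (1 : ℝ) else 0) =
      #s * ∑ v ∈ s, ((c v : ℝ) - 1) / c v) :
    ∃ k, 1 ≤ k ∧ ∀ v ∈ s, c v = k := by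
  obtain ⟨K, hKs, hK, hmax⟩ := G.exists_maximum_clique_subset s
  obtain ⟨x, hx⟩ := hs
  have hKpos : 1 ≤ #K := hmax {x} (by simpa using hx) (by simp)
  have hle : ∀ v ∈ s, c v ≤ #K := fun v hv ↦ by
    obtain ⟨t, ht, htc, h⟩ := hc_attained v hv
    exact h ▸ hmax t ht htc
  have hpos : ∀ v ∈ s, 1 ≤ c v := fun v hv ↦ hc {v} (by simpa using hv) (by simp) v (by simp)
  have h := sum_adj_add_gain_le hc hKs hK (card_pos.1 hKpos) hle
    (sum_adj_le _ _ fun t ht ↦ hc t (ht.trans sdiff_subset))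
  refine ⟨#K, hKpos, fun v hv ↦ le_antisymm (hle v hv) ?_⟩
  by_contra! hlt
  have hvK : v ∈ s \ K := mem_sdiff.2 ⟨hv, fun hvK ↦ hlt.not_ge (hc K hKs hK v hvK)⟩
  have hgain : 0 < ∑ v ∈ s \ K, ((#K : ℝ) - c v) * (2 * c v - 1) / c v := by
    refine sum_pos' (fun u hu ↦ ?_) ⟨v, hvK, ?_⟩
    · have h1 : (1 : ℝ) ≤ c u := by exact_mod_cast hpos u (mem_sdiff.1 hu).1
      have h2 : (c u : ℝ) ≤ #K := by exact_mod_cast hle u (mem_sdiff.1 hu).1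
      exact div_nonneg (mul_nonneg (by linarith) (by linarith)) (by linarith)
    · have h1 : (1 : ℝ) ≤ c v := by exact_mod_cast hpos v hv
      have h2 : (c v : ℝ) < #K := by exact_mod_cast hlt
      exact div_pos (mul_pos (by linarith) (by linarith)) (by linarith)
  linarith

lemma sum_sum_adj_eq_two_mul_card_edgeFinset [Fintype V] [DecidableEq V] [DecidableRel G.Adj] :
    ∑ u : V, ∑ v : V, (if G.Adj u v then (1 : ℝ) else 0) = 2 * #G.edgeFinset := by
  simp_rw [sum_boole, ← neighborFinset_eq_filter, card_neighborFinset_eq_degree]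
  exact_mod_cast G.sum_degrees_eq_twice_card_edges

/-- A `K_{r+1}`-free graph with `(1 - 1/r) n² / 2` edges is Turán-maximal. -/
lemma isTuranMaximal_of_two_mul_card_edgeFinset_eq [Fintype V] [DecidableRel G.Adj] {r : ℕ}
    (hr : 0 < r) (hG : G.CliqueFree (r + 1))
    (h : 2 * r * #G.edgeFinset = (r - 1) * Fintype.card V ^ 2) : G.IsTuranMaximal r := by
  refine ⟨hG, fun H _ hH ↦ ?_⟩
  obtain ⟨M, _, hM⟩ := exists_isTuranMaximal (V := V) hr
  have hMle : 2 * r * #M.edgeFinset ≤ (r - 1) * Fintype.card V ^ 2 := by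
    rw [hM.nonempty_iso_turanGraph.some.card_edgeFinset_eq]
    exact mul_card_edgeFinset_turanGraph_le
  exact (hM.2 hH).trans (Nat.le_of_mul_le_mul_left (hMle.trans h.ge) (by positivity))

/-- The bound `(1 - 1/r) n² / 2` on the size of `turanGraph n r` is attained iff `r ∣ n`. -/
lemma two_mul_card_edgeFinset_turanGraph_eq_iff {n r : ℕ} (hr : 0 < r) :
    2 * r * #(turanGraph n r).edgeFinset = (r - 1) * n ^ 2 ↔ r ∣ n := by
  rw [card_edgeFinset_turanGraph]
  constructor
  · intro h
    rw [Nat.dvd_iff_mod_eq_zero]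
    have hlt : n % r < r := Nat.mod_lt _ hr
    have hle : n % r ≤ n := Nat.mod_le _ _
    set q := n % r
    by_contra hq
    have h1 := Nat.mul_div_le ((n ^ 2 - q ^ 2) * (r - 1)) (2 * r)
    have h2 : 2 * q.choose 2 = q * (q - 1) := by
      rw [Nat.choose_two_right, Nat.mul_div_cancel' (Nat.even_mul_pred_self q).two_dvd]
    have h3 : (r - 1) * n ^ 2 ≤ (n ^ 2 - q ^ 2) * (r - 1) + r * (q * (q - 1)) := by
      rw [← h2, ← h]
      linarith
    have hqn : q ^ 2 ≤ n ^ 2 := Nat.pow_le_pow_left hle 2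
    obtain ⟨r, rfl⟩ := Nat.exists_eq_add_of_lt hr
    obtain ⟨p, hp⟩ := Nat.exists_eq_succ_of_ne_zero hq
    obtain ⟨m, hm⟩ := Nat.exists_eq_add_of_le hqn
    rw [hm, Nat.add_sub_cancel_left, hp] at h3
    rw [hp] at hlt
    simp only [Nat.succ_eq_add_one, Nat.add_sub_cancel, zero_add] at h3 hlt
    nlinarith
  · rintro ⟨m, rfl⟩
    obtain ⟨a, ha⟩ := (Nat.even_mul_pred_self r).two_dvd
    have h : ((r * m) ^ 2 - 0 ^ 2) * (r - 1) = 2 * r * (a * m ^ 2) := by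
      calc _ = (r * (r - 1)) * (r * m ^ 2) := by simp; ring
        _ = _ := by rw [ha]; ring
    rw [Nat.mul_mod_right, h, Nat.mul_div_cancel_left _ (by positivity)]
    simp only [Nat.choose_zero_succ, add_zero]
    rw [← h]
    simp
    ring

end

end SimpleGraph

section

variable {V : Type*} [Fintype V] {G : SimpleGraph V}

lemma bddAbove_cliqueOrders (G : SimpleGraph V) (v : V) :
    BddAbove {r : ℕ | ∃ s : Finset V, G.IsNClique r s ∧ v ∈ s} :=
  ⟨Fintype.card V, fun _ ⟨s, hs, _⟩ ↦ hs.card_eq ▸ card_le_univ s⟩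

lemma card_le_cliqueOrderAt {t : Finset V} (ht : G.IsClique (t : Set V)) {v : V} (hv : v ∈ t) :
    #t ≤ cliqueOrderAt G v :=
  le_csSup (bddAbove_cliqueOrders G v) ⟨t, ⟨ht, rfl⟩, hv⟩

lemma exists_isNClique_cliqueOrderAt (G : SimpleGraph V) (v : V) :
    ∃ t : Finset V, G.IsNClique (cliqueOrderAt G v) t ∧ v ∈ t :=
  Nat.sSup_mem (s := {r : ℕ | ∃ s : Finset V, G.IsNClique r s ∧ v ∈ s})
    ⟨1, {v}, by simp⟩ (bddAbove_cliqueOrders G v)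

lemma one_le_cliqueOrderAt (G : SimpleGraph V) (v : V) : 1 ≤ cliqueOrderAt G v :=
  card_le_cliqueOrderAt (t := {v}) (by simp) (by simp)

lemma cliqueOrderAt_le_of_cliqueFree {r : ℕ} (h : G.CliqueFree (r + 1)) (v : V) :
    cliqueOrderAt G v ≤ r := by
  obtain ⟨t, ht, -⟩ := exists_isNClique_cliqueOrderAt G v
  by_contra! hlt
  exact h.mono hlt t ht

/-- The vertex-localized Turán inequality. -/
theorem card_edgeFinset_le_sum_cliqueOrderAt [DecidableEq V] [DecidableRel G.Adj] :
    (#G.edgeFinset : ℝ) ≤ (Fintype.card V : ℝ) / 2 *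
      ∑ v : V, ((cliqueOrderAt G v : ℝ) - 1) / cliqueOrderAt G v := by
  have h := sum_adj_le (G := G) univ (cliqueOrderAt G)
    fun t _ ht v hv ↦ card_le_cliqueOrderAt ht hv
  rw [sum_sum_adj_eq_two_mul_card_edgeFinset, card_univ] at h
  linarith

end

theorem vertex_localized_turan_weak_equality {V : Type*} [Fintype V] [DecidableEq V]
    (G : SimpleGraph V) [DecidableRel G.Adj] :
    (G.edgeFinset.card : ℝ) =
        ((Fintype.card V : ℝ) / 2) *
          ∑ v : V, ((cliqueOrderAt G v : ℝ) - 1) / (cliqueOrderAt G v) ↔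
      ∃ r : ℕ, 1 ≤ r ∧ r ∣ Fintype.card V ∧
        Nonempty (G ≃g turanGraph (Fintype.card V) r) := by
  constructor
  · intro heq
    obtain ⟨r, hr, hc⟩ : ∃ r, 1 ≤ r ∧ ∀ v, cliqueOrderAt G v = r := by
      cases isEmpty_or_nonempty V
      · exact ⟨1, le_rfl, isEmptyElim⟩
      · simpa using exists_weight_eq_of_sum_adj_eq (G := G) univ_nonempty
          (fun t _ ht v hv ↦ card_le_cliqueOrderAt ht hv)
          (fun v _ ↦ by
            obtain ⟨t, ht, -⟩ := exists_isNClique_cliqueOrderAt G v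
            exact ⟨t, subset_univ t, ht.isClique, ht.card_eq⟩)
          (by rw [sum_sum_adj_eq_two_mul_card_edgeFinset, heq, card_univ]; ring)
    have hfree : G.CliqueFree (r + 1) := fun t ht ↦ by
      obtain ⟨v, hv⟩ : t.Nonempty := card_pos.1 (by rw [ht.card_eq]; omega)
      have := card_le_cliqueOrderAt ht.isClique hv
      rw [ht.card_eq, hc] at this
      omega
    have hcard : 2 * r * #G.edgeFinset = (r - 1) * Fintype.card V ^ 2 := by
      have hr0 : (r : ℝ) ≠ 0 := by exact_mod_cast (by omega : r ≠ 0)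
      simp only [hc, sum_const, card_univ, nsmul_eq_mul] at heq
      rw [← Nat.cast_inj (R := ℝ)]
      push_cast [hr]
      rw [heq]
      field_simp
    obtain ⟨f⟩ := (isTuranMaximal_of_two_mul_card_edgeFinset_eq hr hfree hcard
      ).nonempty_iso_turanGraph
    refine ⟨r, hr, ?_, ⟨f⟩⟩
    rwa [f.card_edgeFinset_eq, two_mul_card_edgeFinset_turanGraph_eq_iff hr] at hcard
  · rintro ⟨r, hr, hdvd, ⟨f⟩⟩
    refine le_antisymm card_edgeFinset_le_sum_cliqueOrderAt ?_
    have hcard := (two_mul_card_edgeFinset_turanGraph_eq_iff hr).2 hdvd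
    rw [← f.card_edgeFinset_eq, ← Nat.cast_inj (R := ℝ)] at hcard
    push_cast [hr] at hcard
    have hr1 : (1 : ℝ) ≤ r := by exact_mod_cast hr
    have hle : ∀ v ∈ univ, ((cliqueOrderAt G v : ℝ) - 1) / cliqueOrderAt G v ≤ (r - 1) / r := by
      intro v _
      have h1 : (1 : ℝ) ≤ cliqueOrderAt G v := by exact_mod_cast one_le_cliqueOrderAt G v
      have h2 : (cliqueOrderAt G v : ℝ) ≤ r := by
        exact_mod_cast cliqueOrderAt_le_of_cliqueFree (isTuranMaximal_of_iso f hr).prop v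
      rw [div_le_div_iff₀ (by linarith) (by linarith)]
      linarith
    calc _ ≤ (Fintype.card V : ℝ) / 2 * ∑ v : V, ((r : ℝ) - 1) / r :=
          mul_le_mul_of_nonneg_left (sum_le_sum hle) (by positivity)
      _ = #G.edgeFinset := by
          rw [sum_const, card_univ, nsmul_eq_mul]
          field_simp
          linarith
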